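/- With the explicit balanced-product chain complex data (G; R₀, R₁, S₀, S₁; A; B; graphs Γ_{*0}, Γ_{*1}, Γ_{0*}, Γ_{1*}; maps L_{*0}, L_{*1}, L_{0*}, L_{1*}, ∂₂, ∂₁) and under the same hypotheses (i), (ii), (iii) as in the small set LTC lemma, assume additionally ε < 1/16. Then every c₁ = (v₁₀, v₀₁) ∈ C₁₀ × C₀₁ that lies in ker ∂₁, is weighted locally minimal, and is nonzero, satisfies |v₁₀| + |v₀₁| ≥ min(c↓·|G|·|R₀|/w↑, c→·|G|·|S₀|, c→·|G|·|S₀|/w←, c↓·|G|·|R₀|). -/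

import Mathlib

open Finset

/-- Neighborhood of a set `S ⊆ V₀` in a bipartite graph with edge set `E ⊆ V₀ × V₁`. -/
def Nbhd {V₀ V₁ : Type*} (E : Set (V₀ × V₁)) (S : Set V₀) : Set V₁ :=
  {x₁ | ∃ x₀ ∈ S, (x₀, x₁) ∈ E}

/-- Every left vertex has exactly `w₀` neighbors. -/
def LeftRegular {V₀ V₁ : Type*} (E : Set (V₀ × V₁)) (w₀ : ℕ) : Prop :=
  ∀ x₀ : V₀, Nat.card {x₁ : V₁ | (x₀, x₁) ∈ E} = w₀

/-- Every right vertex has exactly `w₁` neighbors. -/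
def RightRegular {V₀ V₁ : Type*} (E : Set (V₀ × V₁)) (w₁ : ℕ) : Prop :=
  ∀ x₁ : V₁, Nat.card {x₀ : V₀ | (x₀, x₁) ∈ E} = w₁

/-- Edges of `Γ_{*0}` (resp. `Γ_{*1}`): `((h,r₀,s), (a⁻¹h,r₁,s))` for `a ∈ A(r₀,r₁)`. -/
def edgesA {G R₀ R₁ : Type} [Group G] (A : R₀ × R₁ → Finset G) (S : Type) :
    Set ((G × R₀ × S) × (G × R₁ × S)) :=
  {p | ∃ (h : G) (r₀ : R₀) (r₁ : R₁) (s : S) (a : G),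
    a ∈ A (r₀, r₁) ∧ p = ((h, r₀, s), (a⁻¹ * h, r₁, s))}

/-- Edges of `Γ_{0*}` (resp. `Γ_{1*}`): `((h,r,s₀), (hb,r,s₁))` for `b ∈ B(s₀,s₁)`. -/
def edgesB {G S₀ S₁ : Type} [Group G] (B : S₀ × S₁ → Finset G) (R : Type) :
    Set ((G × R × S₀) × (G × R × S₁)) :=
  {p | ∃ (h : G) (r : R) (s₀ : S₀) (s₁ : S₁) (b : G),
    b ∈ B (s₀, s₁) ∧ p = ((h, r, s₀), (h * b, r, s₁))}

/-- The `ZMod 2` adjacency map of `Γ_{*0}` / `Γ_{*1}`. -/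
def adjA {G R₀ R₁ : Type} [Group G] [Fintype R₀] (A : R₀ × R₁ → Finset G) (S : Type)
    (x : G × R₀ × S → ZMod 2) : G × R₁ × S → ZMod 2 :=
  fun p => ∑ r₀ : R₀, ∑ a ∈ A (r₀, p.2.1), x (a * p.1, r₀, p.2.2)

/-- The `ZMod 2` adjacency map of `Γ_{0*}` / `Γ_{1*}`. -/
def adjB {G S₀ S₁ : Type} [Group G] [Fintype S₀] (B : S₀ × S₁ → Finset G) (R : Type)
    (x : G × R × S₀ → ZMod 2) : G × R × S₁ → ZMod 2 :=
  fun p => ∑ s₀ : S₀, ∑ b ∈ B (s₀, p.2.2), x (p.1 * b⁻¹, p.2.1, s₀)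


open Classical in
/-- number of left neighbors in `U` -/
noncomputable def dL {V W : Type} (E : Set (V × W)) (U : Finset V) (y : W) : ℕ :=
  #{u ∈ U | (u, y) ∈ E}

open Classical in
/-- number of right neighbors in `U` -/
noncomputable def dR {V W : Type} (E : Set (V × W)) (U : Finset W) (x : V) : ℕ :=
  #{u ∈ U | (x, u) ∈ E}

open Classical in
lemma card_left {V W : Type} [Fintype V] [Fintype W] {E : Set (V × W)} {w : ℕ}
    (h : LeftRegular E w) (x : V) : #{y : W | (x, y) ∈ E} = w := by
  have := h x
  rw [← this, Nat.card_eq_fintype_card, ← Set.toFinset_card]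
  congr 1
  ext; simp

open Classical in
lemma card_right {V W : Type} [Fintype V] [Fintype W] {E : Set (V × W)} {w : ℕ}
    (h : RightRegular E w) (x : W) : #{y : V | (y, x) ∈ E} = w := by
  have := h x
  rw [← this, Nat.card_eq_fintype_card, ← Set.toFinset_card]
  congr 1
  ext; simp

open Classical in
lemma sum_dL {V W : Type} [Fintype V] [Fintype W] {E : Set (V × W)} {w : ℕ}
    (h : LeftRegular E w) (U : Finset V) : ∑ y, dL E U y = w * #U := by
  simp only [dL, Finset.card_filter]
  rw [Finset.sum_comm]
  simp only [← Finset.card_filter, card_left h]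
  simp [mul_comm]

open Classical in
lemma sum_dR {V W : Type} [Fintype V] [Fintype W] {E : Set (V × W)} {w : ℕ}
    (h : RightRegular E w) (U : Finset W) : ∑ x, dR E U x = w * #U := by
  simp only [dR, Finset.card_filter]
  rw [Finset.sum_comm]
  simp only [← Finset.card_filter, card_right h]
  simp [mul_comm]

open Classical in
lemma excess {V W : Type} [Fintype V] [Fintype W] {E : Set (V × W)} {w : ℕ}
    (h : LeftRegular E w) (U : Finset V) (c ε : ℝ)
    (hexp : ∀ S : Set V, (Nat.card S : ℝ) < c →
      (1 - ε) * (w : ℝ) * (Nat.card S : ℝ) ≤ (Nat.card (Nbhd E S) : ℝ))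
    (hU : (#U : ℝ) < c) :
    ∑ y, max ((dL E U y : ℝ) - 1) 0 ≤ ε * (w * #U) := by
  have h1 := hexp (U : Set V) (by simpa using hU)
  have h2 : (Nat.card (Nbhd E (U : Set V)) : ℝ) = ∑ y, if 1 ≤ dL E U y then (1 : ℝ) else 0 := by
    rw [Finset.sum_boole, Nat.card_eq_fintype_card, ← Set.toFinset_card]
    congr 2
    ext y
    rw [Set.mem_toFinset]
    simp [Nbhd, dL, Finset.one_le_card, Finset.Nonempty]
  have h3 : ∑ y, max ((dL E U y : ℝ) - 1) 0 =
      ∑ y, ((dL E U y : ℝ) - if 1 ≤ dL E U y then (1 : ℝ) else 0) := by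
    refine Finset.sum_congr rfl fun y _ => ?_
    split_ifs with h
    · exact max_eq_left (by have : (1 : ℝ) ≤ dL E U y := by exact_mod_cast h
                            linarith)
    · have : dL E U y = 0 := by omega
      simp [this]
  have h4 : ∑ y, (dL E U y : ℝ) = w * #U := by exact_mod_cast sum_dL h U
  rw [h3, Finset.sum_sub_distrib, h4, ← h2]
  simp only [Nat.card_eq_fintype_card, Fintype.card_coe, Finset.coe_sort_coe] at h1 ⊢
  linarith

open Classical in
lemma excessR {V W : Type} [Fintype V] [Fintype W] {E : Set (V × W)} {w w' : ℕ}
    (h : LeftRegular E w) (h' : RightRegular E w') (U : Finset W) (c ε : ℝ) (hε : 0 ≤ ε)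
    (hexp : ∀ S : Set V, (Nat.card S : ℝ) < c →
      (1 - ε) * (w : ℝ) * (Nat.card S : ℝ) ≤ (Nat.card (Nbhd E S) : ℝ))
    (hU : (w' : ℝ) * #U < c) :
    ∑ x, max ((dR E U x : ℝ) - ε * w) 0 ≤ #U := by
  set S : Finset V := {x | ε * w < dR E U x} with hS
  have hcard : (#S : ℝ) ≤ w' * #U := by
    have : #S ≤ w' * #U := by
      rw [← sum_dR h' U, Finset.card_filter]
      refine Finset.sum_le_sum fun x _ => ?_
      split_ifs with h
      · have : (0 : ℝ) < dR E U x := lt_of_le_of_lt (by positivity) h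
        exact_mod_cast this
      · simp
    exact_mod_cast this
  have h1 := excess h S c ε hexp (by linarith)
  have h2 : ∑ x, max ((dR E U x : ℝ) - ε * w) 0 = ∑ x ∈ S, ((dR E U x : ℝ) - ε * w) := by
    rw [hS, Finset.sum_filter]
    refine Finset.sum_congr rfl fun x _ => ?_
    split_ifs with h
    · exact max_eq_left (by linarith)
    · exact max_eq_right (by linarith)
  have h3 : ∑ x ∈ S, (dR E U x : ℝ) = ∑ u ∈ U, (dL E S u : ℝ) := by
    have : ∑ x ∈ S, dR E U x = ∑ u ∈ U, dL E S u := by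
      simp only [dR, dL, Finset.card_filter]
      exact Finset.sum_comm
    exact_mod_cast this
  have h4 : ∑ u ∈ U, (dL E S u : ℝ) ≤ ∑ u ∈ U, (1 + max ((dL E S u : ℝ) - 1) 0) :=
    Finset.sum_le_sum fun u _ => by linarith [le_max_left ((dL E S u : ℝ) - 1) 0]
  have h5 : ∑ u ∈ U, max ((dL E S u : ℝ) - 1) 0 ≤ ∑ u, max ((dL E S u : ℝ) - 1) 0 :=
    Finset.sum_le_sum_of_subset_of_nonneg (Finset.subset_univ _) fun _ _ _ => le_max_right _ _
  rw [Finset.sum_add_distrib] at h4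
  rw [h2, Finset.sum_sub_distrib, h3]
  simp only [Finset.sum_const, nsmul_eq_mul, mul_one] at h4 ⊢
  linarith

lemma mem_edgesA {G R₀ R₁ S : Type} [Group G] (A : R₀ × R₁ → Finset G)
    (h g : G) (r₀ : R₀) (r₁ : R₁) (s s' : S) :
    ((h, r₀, s), (g, r₁, s')) ∈ edgesA A S ↔ s = s' ∧ h * g⁻¹ ∈ A (r₀, r₁) := by
  constructor
  · rintro ⟨h', r, r', t, a, ha, he⟩
    simp only [Prod.mk.injEq] at he
    obtain ⟨⟨rfl, rfl, rfl⟩, rfl, rfl, rfl⟩ := he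
    simpa using ha
  · rintro ⟨rfl, ha⟩
    exact ⟨h, r₀, r₁, s, _, ha, by simp⟩

lemma mem_edgesB {G S₀ S₁ R : Type} [Group G] (B : S₀ × S₁ → Finset G)
    (h g : G) (r r' : R) (s₀ : S₀) (s₁ : S₁) :
    ((h, r, s₀), (g, r', s₁)) ∈ edgesB B R ↔ r = r' ∧ h⁻¹ * g ∈ B (s₀, s₁) := by
  constructor
  · rintro ⟨h', t, s, s', a, ha, he⟩
    simp only [Prod.mk.injEq] at he
    obtain ⟨⟨rfl, rfl, rfl⟩, rfl, rfl, rfl⟩ := he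
    simpa using ha
  · rintro ⟨rfl, ha⟩
    exact ⟨h, r, s₀, s₁, _, ha, by simp⟩

open Classical in
lemma adjA_eq {G R₀ R₁ S : Type} [Group G] [Fintype G] [Fintype R₀] [Fintype S]
    (A : R₀ × R₁ → Finset G) (x : G × R₀ × S → ZMod 2) (p : G × R₁ × S) :
    adjA A S x p = ∑ q, if (q, p) ∈ edgesA A S then x q else 0 := by
  obtain ⟨g, r₁, s⟩ := p
  simp only [Fintype.sum_prod_type, mem_edgesA, adjA]
  rw [Finset.sum_comm]
  refine Finset.sum_congr rfl fun r₀ _ => ?_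
  have : ∀ h : G, (∑ t : S, if t = s ∧ h * g⁻¹ ∈ A (r₀, r₁) then x (h, r₀, t) else 0)
      = if h * g⁻¹ ∈ A (r₀, r₁) then x (h, r₀, s) else 0 := by
    intro h
    simp [ite_and]
  simp only [this]
  rw [← Equiv.sum_comp (Equiv.mulRight g)]
  simp

open Classical in
lemma adjB_eq {G S₀ S₁ R : Type} [Group G] [Fintype G] [Fintype S₀] [Fintype R]
    (B : S₀ × S₁ → Finset G) (x : G × R × S₀ → ZMod 2) (p : G × R × S₁) :
    adjB B R x p = ∑ q, if (q, p) ∈ edgesB B R then x q else 0 := by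
  obtain ⟨g, r, s₁⟩ := p
  simp only [Fintype.sum_prod_type, mem_edgesB, adjB]
  have : ∀ h : G, (∑ t : R, ∑ s₀ : S₀,
      if t = r ∧ h⁻¹ * g ∈ B (s₀, s₁) then x (h, t, s₀) else 0)
      = ∑ s₀ : S₀, if h⁻¹ * g ∈ B (s₀, s₁) then x (h, r, s₀) else 0 := by
    intro h
    rw [Finset.sum_comm]
    simp [ite_and]
  simp only [this]
  rw [Finset.sum_comm]
  refine Finset.sum_congr rfl fun s₀ _ => ?_
  rw [← Equiv.sum_comp ((Equiv.inv G).trans (Equiv.mulLeft g))]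
  simp

open Classical in
lemma sum_parity {V W : Type} [Fintype V] (E : Set (V × W)) (x : V → ZMod 2) (y : W) :
    (∑ q, if (q, y) ∈ E then x q else 0) = (dL E {q | x q ≠ 0} y : ZMod 2) := by
  rw [dL, Finset.filter_filter, Finset.natCast_card_filter]
  refine Finset.sum_congr rfl fun q _ => ?_
  have : ∀ a : ZMod 2, a = 0 ∨ a = 1 := by decide
  rcases this (x q) with h | h <;> simp [h]

open Classical in
lemma norm_flip {α : Type} [Fintype α] (v : α → ZMod 2) (P : α → Prop) :
    (hammingNorm (v + fun a => if P a then 1 else 0) : ℝ) =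
      hammingNorm v + #{a | P a} - 2 * #{a ∈ ({a | v a ≠ 0} : Finset α) | P a} := by
  rw [Finset.filter_filter]
  simp only [hammingNorm, Finset.natCast_card_filter, Finset.mul_sum, ← Finset.sum_add_distrib,
    ← Finset.sum_sub_distrib]
  refine Finset.sum_congr rfl fun q _ => ?_
  have : ∀ a : ZMod 2, a = 0 ∨ a = 1 := by decide
  have h11 : (1 : ZMod 2) + 1 = 0 := by decide
  rcases this (v q) with h | h <;> by_cases hP : P q <;> simp [h, hP, h11] <;> norm_num

open Classical in
lemma norm_flipR {V W : Type} [Fintype V] [Fintype W] {E : Set (V × W)} {w : ℕ}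
    (h : LeftRegular E w) (v : W → ZMod 2) (U : Finset W) (hU : ∀ a, a ∈ U ↔ v a ≠ 0) (z : V)
    (f : W → ZMod 2) (hf : ∀ a, f a = if (z, a) ∈ E then 1 else 0) :
    (hammingNorm (v + f) : ℝ) = hammingNorm v + w - 2 * dR E U z := by
  have h1 : f = fun a => if (z, a) ∈ E then 1 else 0 := funext hf
  have h2 : U = ({a | v a ≠ 0} : Finset W) := by ext a; simp [hU]
  rw [h1, norm_flip, card_left h, dR, h2]

open Classical in
lemma squares {G R₀ R₁ S₀ S₁ : Type} [Group G] [Fintype G]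
    [Fintype R₀] [Fintype R₁] [Fintype S₀] [Fintype S₁]
    (A : R₀ × R₁ → Finset G) (B : S₀ × S₁ → Finset G)
    (u : G × R₁ × S₀) (v : G × R₀ × S₁) :
    #{x : G × R₀ × S₀ | (x, u) ∈ edgesA A S₀ ∧ (x, v) ∈ edgesB B R₀} =
    #{y : G × R₁ × S₁ | (u, y) ∈ edgesB B R₁ ∧ (v, y) ∈ edgesA A S₁} := by
  obtain ⟨g, r₁, s₀⟩ := u
  obtain ⟨h, r₀, s₁⟩ := v
  refine Finset.card_bij' (fun x _ => (g * x.1⁻¹ * h, r₁, s₁))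
    (fun y _ => (h * y.1⁻¹ * g, r₀, s₀)) ?_ ?_ ?_ ?_
  · rintro ⟨k, a, b⟩ hx
    simp only [Finset.mem_filter, Finset.mem_univ, true_and, mem_edgesA, mem_edgesB] at hx ⊢
    obtain ⟨⟨rfl, h1⟩, rfl, h2⟩ := hx
    simpa [mul_assoc] using ⟨h2, h1⟩
  · rintro ⟨k, a, b⟩ hx
    simp only [Finset.mem_filter, Finset.mem_univ, true_and, mem_edgesA, mem_edgesB] at hx ⊢
    obtain ⟨⟨rfl, h1⟩, rfl, h2⟩ := hx
    simpa [mul_assoc] using ⟨h2, h1⟩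
  · rintro ⟨k, a, b⟩ hx
    simp only [Finset.mem_filter, Finset.mem_univ, true_and, mem_edgesA, mem_edgesB] at hx ⊢
    obtain ⟨⟨rfl, h1⟩, rfl, h2⟩ := hx
    simp [mul_assoc]
  · rintro ⟨k, a, b⟩ hx
    simp only [Finset.mem_filter, Finset.mem_univ, true_and, mem_edgesA, mem_edgesB] at hx ⊢
    obtain ⟨⟨rfl, h1⟩, rfl, h2⟩ := hx
    simp [mul_assoc]

open Classical in
lemma sum_squares {G R₀ R₁ S₀ S₁ : Type} [Group G] [Fintype G]
    [Fintype R₀] [Fintype R₁] [Fintype S₀] [Fintype S₁]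
    (A : R₀ × R₁ → Finset G) (B : S₀ × S₁ → Finset G)
    (U : Finset (G × R₁ × S₀)) (W : Finset (G × R₀ × S₁)) :
    ∑ x, dR (edgesA A S₀) U x * dR (edgesB B R₀) W x =
    ∑ y, dL (edgesB B R₁) U y * dL (edgesA A S₁) W y := by
  simp only [dR, dL, Finset.card_filter, Finset.sum_mul_sum]
  rw [Finset.sum_comm, Finset.sum_comm (s := univ) (t := U)]
  refine Finset.sum_congr rfl fun u _ => ?_
  rw [Finset.sum_comm, Finset.sum_comm (s := univ) (t := W)]
  refine Finset.sum_congr rfl fun v _ => ?_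
  have := squares A B u v
  simp only [and_comm (a := (_, u) ∈ edgesA A S₀), and_comm (a := (u, _) ∈ edgesB B R₁)] at this
  simpa only [Finset.card_filter, ite_and, ite_mul, one_mul, zero_mul, mul_ite, mul_one, mul_zero,
    ite_zero_mul_ite_zero] using this

lemma upper_pt (P Q wd wr εd εr : ℝ) (hP : 0 ≤ P) (hwd : 0 < wd) (hwr : 0 < wr)
    (hεd : 0 < εd) (hεr : 0 < εr) (hQ : 0 ≤ Q)
    (hm : P / wd + Q / wr ≤ 1) :
    P * Q ≤ εr * wr * P + εd * wd * max (Q - εr * wr) 0 +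
      1 / 4 * (wr * max (P - εd * wd) 0 + wd * max (Q - εr * wr) 0) := by
  set P' := max (P - εd * wd) 0 with hP'
  set Q' := max (Q - εr * wr) 0 with hQ'
  have a1 : 0 ≤ P' := le_max_right _ _
  have a2 : 0 ≤ Q' := le_max_right _ _
  have a3 : P ≤ εd * wd + P' := by linarith [le_max_left (P - εd * wd) 0]
  have a4 : Q ≤ εr * wr + Q' := by linarith [le_max_left (Q - εr * wr) 0]
  have a5 : P' ≤ P := max_le (by nlinarith [mul_pos hεd hwd]) hP
  have a6 : Q' ≤ Q := max_le (by nlinarith [mul_pos hεr hwr]) hQ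
  have b1 : P * Q ≤ P * (εr * wr + Q') := by gcongr
  have b2 : P * Q' ≤ (εd * wd + P') * Q' := by gcongr
  have b3 : P' * Q' ≤ 1 / 4 * (wr * P' + wd * Q') := by
    have c1 : P' / wd + Q' / wr ≤ 1 := le_trans (by gcongr) hm
    set p := P' / wd with hp
    set q := Q' / wr with hq
    have e1 : P' = p * wd := by rw [hp]; field_simp
    have e2 : Q' = q * wr := by rw [hq]; field_simp
    have p0 : 0 ≤ p := by positivity
    have q0 : 0 ≤ q := by positivity
    have : 4 * (p * q) ≤ p + q := by nlinarith [sq_nonneg (p - q)]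
    rw [e1, e2]
    nlinarith [mul_le_mul_of_nonneg_left this (mul_pos hwd hwr).le]
  linarith

lemma lower_pt (a b : ℕ) (h : (a : ZMod 2) + b = 0) :
    ((a : ℝ) + b) / 2 - max ((a : ℝ) - 1) 0 - max ((b : ℝ) - 1) 0 ≤ (a : ℝ) * b := by
  have hpar : 2 ∣ a + b := by
    rw [← CharP.cast_eq_zero_iff (ZMod 2) 2]; exact_mod_cast h
  have m1 := le_max_left ((a : ℝ) - 1) 0
  have m2 := le_max_left ((b : ℝ) - 1) 0
  have m3 := le_max_right ((a : ℝ) - 1) 0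
  have m4 := le_max_right ((b : ℝ) - 1) 0
  rcases Nat.eq_zero_or_pos a with ha | ha
  · subst ha
    rcases Nat.eq_zero_or_pos b with hb | hb
    · subst hb; simp
    · have : (2 : ℝ) ≤ b := by exact_mod_cast (by omega : 2 ≤ b)
      have m0 : max ((0 : ℝ) - 1) 0 = 0 := by norm_num
      push_cast at *
      rw [m0]
      linarith
  · rcases Nat.eq_zero_or_pos b with hb | hb
    · subst hb
      have : (2 : ℝ) ≤ a := by exact_mod_cast (by omega : 2 ≤ a)
      have m0 : max ((0 : ℝ) - 1) 0 = 0 := by norm_num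
      push_cast at *
      rw [m0]
      linarith
    · have h1 : (1 : ℝ) ≤ a := by exact_mod_cast ha
      have h2 : (1 : ℝ) ≤ b := by exact_mod_cast hb
      nlinarith [mul_nonneg (sub_nonneg.2 h1) (sub_nonneg.2 h2)]

set_option maxHeartbeats 2000000

/-- small set LTC implies linear locally minimal distance — a
nonzero weighted locally minimal `c₁ = (v₁₀, v₀₁) ∈ ker ∂₁` has weight at least
`min(c↓·|G|·|R₀|/w↑, c→·|G|·|S₀|, c→·|G|·|S₀|/w←, c↓·|G|·|R₀|)`. -/
theorem small_set_LTC_implies_locally_minimal_distance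
    (G : Type) [Group G] [Fintype G] [DecidableEq G]
    (R₀ R₁ S₀ S₁ : Type) [Fintype R₀] [Fintype R₁] [Fintype S₀] [Fintype S₁]
    [DecidableEq R₀] [DecidableEq R₁] [DecidableEq S₀] [DecidableEq S₁]
    (A : R₀ × R₁ → Finset G) (B : S₀ × S₁ → Finset G)
    (wd wu wr wl : ℕ) (hwd : 1 ≤ wd) (hdu : wd < wu) (hwr : 1 ≤ wr) (hrl : wr < wl)
    -- (i) regularity of the four graphs
    (hreg1 : LeftRegular (edgesA A S₀) wd) (hreg2 : RightRegular (edgesA A S₀) wu)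
    (hreg3 : LeftRegular (edgesA A S₁) wd) (hreg4 : RightRegular (edgesA A S₁) wu)
    (hreg5 : LeftRegular (edgesB B R₀) wr) (hreg6 : RightRegular (edgesB B R₀) wl)
    (hreg7 : LeftRegular (edgesB B R₁) wr) (hreg8 : RightRegular (edgesB B R₁) wl)
    -- (ii) expansion
    (cd cr εd εr : ℝ) (hcd : 0 < cd) (hcr : 0 < cr) (hεd : 0 < εd) (hεr : 0 < εr)
    (hεdwd : 1 ≤ εd * wd) (hεrwr : 1 ≤ εr * wr)
    (hexp1 : ∀ S : Set (G × R₀ × S₀),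
      (Nat.card S : ℝ) < cd * ((Fintype.card G : ℝ) * (Fintype.card R₀ : ℝ)) →
      (1 - εd) * (wd : ℝ) * (Nat.card S : ℝ) ≤ (Nat.card (Nbhd (edgesA A S₀) S) : ℝ))
    (hexp2 : ∀ S : Set (G × R₀ × S₁),
      (Nat.card S : ℝ) < cd * ((Fintype.card G : ℝ) * (Fintype.card R₀ : ℝ)) →
      (1 - εd) * (wd : ℝ) * (Nat.card S : ℝ) ≤ (Nat.card (Nbhd (edgesA A S₁) S) : ℝ))
    (hexp3 : ∀ S : Set (G × R₀ × S₀),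
      (Nat.card S : ℝ) < cr * ((Fintype.card G : ℝ) * (Fintype.card S₀ : ℝ)) →
      (1 - εr) * (wr : ℝ) * (Nat.card S : ℝ) ≤ (Nat.card (Nbhd (edgesB B R₀) S) : ℝ))
    (hexp4 : ∀ S : Set (G × R₁ × S₀),
      (Nat.card S : ℝ) < cr * ((Fintype.card G : ℝ) * (Fintype.card S₀ : ℝ)) →
      (1 - εr) * (wr : ℝ) * (Nat.card S : ℝ) ≤ (Nat.card (Nbhd (edgesB B R₁) S) : ℝ))
    -- (iii), with additionally ε < 1/16
    (ε : ℝ) (hε : 0 < ε) (hε1 : (wu : ℝ) * εr ≤ ε) (hε2 : εd ≤ ε) (hε3 : ε < 1 / 16)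
    -- the vector c₁ = (v₁₀, v₀₁)
    (v10 : G × R₁ × S₀ → ZMod 2) (v01 : G × R₀ × S₁ → ZMod 2)
    -- c₁ ∈ ker ∂₁
    (hker : adjB B R₁ v10 + adjA A S₁ v01 = 0)
    -- weighted locally minimal
    (hmin : ∀ z : G × R₀ × S₀,
      (hammingNorm v10 : ℝ) / wd + (hammingNorm v01 : ℝ) / wr ≤
        (hammingNorm (v10 + adjA A S₀ (Pi.single z 1)) : ℝ) / wd +
        (hammingNorm (v01 + adjB B R₀ (Pi.single z 1)) : ℝ) / wr)
    -- nonzero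
    (hne : ¬(v10 = 0 ∧ v01 = 0)) :
    min (min (cd * ((Fintype.card G : ℝ) * (Fintype.card R₀ : ℝ)) / wu)
             (cr * ((Fintype.card G : ℝ) * (Fintype.card S₀ : ℝ))))
        (min (cr * ((Fintype.card G : ℝ) * (Fintype.card S₀ : ℝ)) / wl)
             (cd * ((Fintype.card G : ℝ) * (Fintype.card R₀ : ℝ)))) ≤
      (hammingNorm v10 : ℝ) + (hammingNorm v01 : ℝ) := by
  classical
  by_contra hcon
  push Not at hcon
  rw [lt_min_iff, lt_min_iff, lt_min_iff] at hcon
  obtain ⟨⟨k1, k2⟩, k3, k4⟩ := hcon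
  set U : Finset (G × R₁ × S₀) := {q | v10 q ≠ 0} with hU
  set W : Finset (G × R₀ × S₁) := {q | v01 q ≠ 0} with hW
  have nU : hammingNorm v10 = #U := by
    rw [hammingNorm, hU]
  have nW : hammingNorm v01 = #W := by
    rw [hammingNorm, hW]
  have hwd' : (0 : ℝ) < wd := by exact_mod_cast hwd
  have hwr' : (0 : ℝ) < wr := by exact_mod_cast hwr
  have hwu' : (1 : ℝ) ≤ wu := by exact_mod_cast (by omega : 1 ≤ wu)
  have hwl' : (1 : ℝ) ≤ wl := by exact_mod_cast (by omega : 1 ≤ wl)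
  have U0 : (0 : ℝ) ≤ #U := by positivity
  have W0 : (0 : ℝ) ≤ #W := by positivity
  rw [nU, nW] at k1 k2 k3 k4
  rw [lt_div_iff₀ (by linarith)] at k1 k3
  have x1 := excess hreg7 U _ εr hexp4 (by linarith)
  have x2 := excess hreg3 W _ εd hexp2 (by linarith)
  have x3 := excessR hreg1 hreg2 U _ εd hεd.le hexp1 (by nlinarith [mul_nonneg W0 (by linarith : (0 : ℝ) ≤ wu)])
  have x4 := excessR hreg5 hreg6 W _ εr hεr.le hexp3 (by nlinarith [mul_nonneg U0 (by linarith : (0 : ℝ) ≤ wl)])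
  have hloc : ∀ z, (dR (edgesA A S₀) U z : ℝ) / wd + (dR (edgesB B R₀) W z : ℝ) / wr ≤ 1 := by
    intro z
    have h := hmin z
    rw [norm_flipR hreg1 v10 U (by simp [hU]) z, norm_flipR hreg5 v01 W (by simp [hW]) z] at h
    rotate_left
    · intro p
      rw [adjB_eq, Finset.sum_eq_single z] <;> simp +contextual
    · intro p
      rw [adjA_eq, Finset.sum_eq_single z] <;> simp +contextual
    have g1 : (wd : ℝ) / wd = 1 := div_self hwd'.ne'
    have g2 : (wr : ℝ) / wr = 1 := div_self hwr'.ne'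
    simp only [sub_div, add_div, g1, g2, mul_div_assoc] at h
    linarith
  have hpar : ∀ y, (dL (edgesB B R₁) U y : ZMod 2) + dL (edgesA A S₁) W y = 0 := by
    intro y
    have h := congrFun hker y
    simp only [Pi.add_apply, Pi.zero_apply, adjA_eq, adjB_eq, sum_parity] at h
    convert h
  have hsq : ∑ x, (dR (edgesA A S₀) U x : ℝ) * dR (edgesB B R₀) W x =
    ∑ y, (dL (edgesB B R₁) U y : ℝ) * dL (edgesA A S₁) W y := by
    exact_mod_cast sum_squares A B U W
  have up := Finset.sum_le_sum (s := univ) fun x _ =>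
    upper_pt (dR (edgesA A S₀) U x : ℝ) (dR (edgesB B R₀) W x) wd wr εd εr (by positivity)
      hwd' hwr' hεd hεr (by positivity) (hloc x)
  have lo := Finset.sum_le_sum (s := univ) fun y _ => lower_pt _ _ (hpar y)
  simp only [Finset.sum_add_distrib, Finset.sum_sub_distrib, ← Finset.mul_sum,
    ← Finset.sum_div] at up lo
  have s1 : ∑ x, (dR (edgesA A S₀) U x : ℝ) = wu * #U := by exact_mod_cast sum_dR hreg2 U
  have s2 : ∑ x, (dL (edgesB B R₁) U x : ℝ) = wr * #U := by exact_mod_cast sum_dL hreg7 U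
  have s3 : ∑ x, (dL (edgesA A S₁) W x : ℝ) = wd * #W := by exact_mod_cast sum_dL hreg3 W
  rw [s2, s3] at lo
  rw [s1, hsq] at up
  have a0 : 0 ≤ (wr : ℝ) * #U := by positivity
  have b0 : 0 ≤ (wd : ℝ) * #W := by positivity
  have εr' : εr ≤ ε := by nlinarith
  have t1 : εr * wr * (wu * #U) ≤ ε * (wr * #U) := by
    have := mul_le_mul_of_nonneg_right hε1 a0
    linarith
  have t2 := mul_le_mul_of_nonneg_left x4 (mul_pos hεd hwd').le
  have t2' := mul_le_mul_of_nonneg_right hε2 b0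
  have t3 := mul_le_mul_of_nonneg_left x3 hwr'.le
  have t4 := mul_le_mul_of_nonneg_left x4 hwd'.le
  have t5 := mul_le_mul_of_nonneg_right εr' a0
  have pos : 0 < (wr : ℝ) * #U + wd * #W := by
    by_contra hn
    have z1 : (wr : ℝ) * #U = 0 := by linarith
    have z2 : (wd : ℝ) * #W = 0 := by linarith
    have z1' : #U = 0 := by
      rcases mul_eq_zero.1 z1 with h | h
      · linarith
      · exact_mod_cast h
    have z2' : #W = 0 := by
      rcases mul_eq_zero.1 z2 with h | h
      · linarith
      · exact_mod_cast h
    exact hne ⟨hammingNorm_eq_zero.1 (nU.trans z1'), hammingNorm_eq_zero.1 (nW.trans z2')⟩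
  have fin1 : (1 / 2 - ε) * ((wr : ℝ) * #U + wd * #W) ≤
      (1 / 4 + ε) * ((wr : ℝ) * #U + wd * #W) := by linarith
  have := le_of_mul_le_mul_right fin1 pos
  linarith
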